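/- arXiv:2105.10241 — 3 statements merged into one kernel-verified Lean document; each statement's English description precedes it below -/
import Mathlib

section
/- Let g : ℝⁿ → ℝⁿ, and let S ⊂ D ⊆ ℝⁿ be nonempty, compact sets that are both positively invariant for the autonomous system x(k+1) = g(x(k)). If there exists a Lyapunov function V for this system with respect to S in D, then S is an asymptotically stable set for the system in D, i.e., for all x(0) ∈ D: (i) for every ε > 0 there exists δ > 0 such that |x(0)|_S < δ implies |x(k)|_S < ε for all k > 0, and (ii) there exists δ̄ > 0 such that |x(0)|_S < δ̄ implies |x(k)|_S → 0 as k → ∞. -/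
open Set Metric Filter

/-- On a compact set, if a continuous `h` is positive only where a continuous `f` is, then `h` is
uniformly small wherever `f` is small. -/
theorem IsCompact.exists_pos_forall_lt_imp_lt {X : Type*} [TopologicalSpace X] {D : Set X}
    (hD : IsCompact D) {f h : X → ℝ} (hf : ContinuousOn f D) (hh : ContinuousOn h D)
    (hpos : ∀ x ∈ D, 0 < h x → 0 < f x) {ε : ℝ} (hε : 0 < ε) :
    ∃ δ > 0, ∀ x ∈ D, f x < δ → h x < ε := by
  have hK : IsCompact {x ∈ D | ε ≤ h x} := by
    obtain ⟨u, hu, hDu⟩ := (continuousOn_iff_isClosed.1 hh) (Ici ε) isClosed_Ici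
    have hEq : {x ∈ D | ε ≤ h x} = D ∩ u := by
      rw [inter_comm, ← hDu, inter_comm]
      rfl
    rw [hEq]
    exact hD.inter_right hu
  rcases {x ∈ D | ε ≤ h x}.eq_empty_or_nonempty with hempty | hne
  · refine ⟨1, one_pos, fun x hx _ => ?_⟩
    by_contra! hle
    exact (hempty ▸ (⟨hx, hle⟩ : x ∈ {x ∈ D | ε ≤ h x}) : x ∈ (∅ : Set X))
  · obtain ⟨y, hy, hmin⟩ := hK.exists_isMinOn hne (hf.mono (sep_subset _ _))
    refine ⟨f y, hpos y hy.1 (hε.trans_le hy.2), fun x hx hlt => ?_⟩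
    by_contra! hle
    exact hlt.not_ge (hmin ⟨hx, hle⟩)

section Lyapunov

variable {X : Type*} {g : X → X} {S D : Set X} {V ΔV : X → ℝ}

theorem nonneg_of_zero_of_pos_on_diff {W : X → ℝ} (hzero : ∀ x ∈ S, W x = 0)
    (hpos : ∀ x ∈ D \ S, 0 < W x) {x : X} (hx : x ∈ D) : 0 ≤ W x := by
  by_cases hxS : x ∈ S
  · exact (hzero x hxS).ge
  · exact (hpos x ⟨hx, hxS⟩).le

theorem antitone_iterate_of_decrease (hDinv : MapsTo g D D) (hΔV : ∀ x ∈ D, 0 ≤ ΔV x)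
    (hdecrease : ∀ x ∈ D, V (g x) - V x ≤ -ΔV x) {x : X} (hx : x ∈ D) :
    Antitone fun k => V (g^[k] x) := by
  refine antitone_nat_of_succ_le fun k => ?_
  have hk := hDinv.iterate k hx
  rw [Function.iterate_succ_apply']
  linarith [hdecrease _ hk, hΔV _ hk]

theorem tendsto_iterate_decrement_zero (hDinv : MapsTo g D D) (hV : ∀ x ∈ D, 0 ≤ V x)
    (hΔV : ∀ x ∈ D, 0 ≤ ΔV x) (hdecrease : ∀ x ∈ D, V (g x) - V x ≤ -ΔV x) {x : X}
    (hx : x ∈ D) : Tendsto (fun k => ΔV (g^[k] x)) atTop (nhds 0) := by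
  have hlim := tendsto_atTop_ciInf (antitone_iterate_of_decrease hDinv hΔV hdecrease hx)
    ⟨0, by rintro _ ⟨k, rfl⟩; exact hV _ (hDinv.iterate k hx)⟩
  have hdiff := hlim.sub (hlim.comp (tendsto_add_atTop_nat 1))
  rw [sub_self] at hdiff
  refine squeeze_zero (fun k => hΔV _ (hDinv.iterate k hx)) (fun k => ?_) hdiff
  have hk := hdecrease _ (hDinv.iterate k hx)
  simp only [Function.comp_apply, Function.iterate_succ_apply']
  linarith

variable [PseudoMetricSpace X]

/-- Stability of `S` in `D`, uniformly in the initial condition. -/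
theorem exists_pos_forall_infDist_iterate_lt (hSne : S.Nonempty) (hS : IsClosed S)
    (hD : IsCompact D) (hDinv : MapsTo g D D) (hVcont : ContinuousOn V D)
    (hVzero : ∀ x ∈ S, V x = 0) (hVpos : ∀ x ∈ D \ S, 0 < V x) (hΔV : ∀ x ∈ D, 0 ≤ ΔV x)
    (hdecrease : ∀ x ∈ D, V (g x) - V x ≤ -ΔV x) {ε : ℝ} (hε : 0 < ε) :
    ∃ δ > 0, ∀ x ∈ D, infDist x S < δ → ∀ k, infDist (g^[k] x) S < ε := by
  have hdist : ContinuousOn (fun x => infDist x S) D := (continuous_infDist_pt S).continuousOn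
  obtain ⟨η, hη, hVη⟩ := hD.exists_pos_forall_lt_imp_lt hVcont hdist
    (fun x hx h => hVpos x ⟨hx, (hS.notMem_iff_infDist_pos hSne).2 h⟩) hε
  obtain ⟨δ, hδ, hδη⟩ := hD.exists_pos_forall_lt_imp_lt hdist hVcont
    (fun x _ h => (hS.notMem_iff_infDist_pos hSne).1 fun hxS => h.ne' (hVzero x hxS)) hη
  refine ⟨δ, hδ, fun x hx hxδ k => hVη _ (hDinv.iterate k hx) ?_⟩
  exact (antitone_iterate_of_decrease hDinv hΔV hdecrease hx k.zero_le).trans_lt (hδη x hx hxδ)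

/-- Every trajectory starting in `D` converges to `S`. -/
theorem tendsto_infDist_iterate_zero (hSne : S.Nonempty) (hS : IsClosed S)
    (hD : IsCompact D) (hDinv : MapsTo g D D) (hV : ∀ x ∈ D, 0 ≤ V x)
    (hΔVcont : ContinuousOn ΔV D) (hΔV : ∀ x ∈ D, 0 ≤ ΔV x) (hΔVpos : ∀ x ∈ D \ S, 0 < ΔV x)
    (hdecrease : ∀ x ∈ D, V (g x) - V x ≤ -ΔV x) {x : X} (hx : x ∈ D) :
    Tendsto (fun k => infDist (g^[k] x) S) atTop (nhds 0) := by
  refine tendsto_order.2 ⟨fun a ha => .of_forall fun k => ha.trans_le infDist_nonneg,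
    fun ε hε => ?_⟩
  obtain ⟨η, hη, hΔη⟩ := hD.exists_pos_forall_lt_imp_lt hΔVcont
    (continuous_infDist_pt S).continuousOn
    (fun x hx h => hΔVpos x ⟨hx, (hS.notMem_iff_infDist_pos hSne).2 h⟩) hε
  filter_upwards [(tendsto_iterate_decrement_zero hDinv hV hΔV hdecrease hx).eventually_lt_const hη]
    with k hk using hΔη _ (hDinv.iterate k hx) hk

end Lyapunov

/-- If `V` is a Lyapunov function for the autonomous system
`x(k+1) = g(x(k))` with respect to the nonempty compact positively invariant set `S`
inside the nonempty compact positively invariant set `D ⊇ S`, then `S` is an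
asymptotically stable set for the system in `D`. -/
theorem lyapunov_implies_asymptotic_stability {n : ℕ}
    (g : EuclideanSpace ℝ (Fin n) → EuclideanSpace ℝ (Fin n))
    (S D : Set (EuclideanSpace ℝ (Fin n)))
    (hSne : S.Nonempty) (hDne : D.Nonempty)
    (hScomp : IsCompact S) (hDcomp : IsCompact D)
    (hSD : S ⊆ D)
    (hSinv : ∀ x ∈ S, g x ∈ S) (hDinv : ∀ x ∈ D, g x ∈ D)
    (V ΔV : EuclideanSpace ℝ (Fin n) → ℝ)
    (hVcont : ContinuousOn V D)
    (hVzero : ∀ x ∈ S, V x = 0) (hVpos : ∀ x ∈ D \ S, 0 < V x)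
    (hΔVcont : ContinuousOn ΔV D)
    (hΔVzero : ∀ x ∈ S, ΔV x = 0) (hΔVpos : ∀ x ∈ D \ S, 0 < ΔV x)
    (hdecrease : ∀ x ∈ D, V (g x) - V x ≤ -ΔV x) :
    ∀ x₀ ∈ D,
      (∀ ε > (0 : ℝ), ∃ δ > (0 : ℝ), infDist x₀ S < δ →
          ∀ k > 0, infDist (g^[k] x₀) S < ε) ∧
      (∃ δ' > (0 : ℝ), infDist x₀ S < δ' →
          Tendsto (fun k => infDist (g^[k] x₀) S) atTop (nhds 0)) := by
  intro x₀ hx₀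
  have hV : ∀ x ∈ D, 0 ≤ V x := fun x => nonneg_of_zero_of_pos_on_diff hVzero hVpos
  have hΔV : ∀ x ∈ D, 0 ≤ ΔV x := fun x => nonneg_of_zero_of_pos_on_diff hΔVzero hΔVpos
  refine ⟨fun ε hε => ?_, 1, one_pos, fun _ => tendsto_infDist_iterate_zero hSne
    hScomp.isClosed hDcomp hDinv hV hΔVcont hΔV hΔVpos hdecrease hx₀⟩
  obtain ⟨δ, hδ, hstable⟩ := exists_pos_forall_infDist_iterate_lt hSne hScomp.isClosed hDcomp
    hDinv hVcont hVzero hVpos hΔV hdecrease hε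
  exact ⟨δ, hδ, fun h k _ => hstable x₀ hx₀ h k⟩
end

section
/- Let g : ℝⁿ → ℝⁿ, let S ⊂ D ⊆ ℝⁿ be nonempty, compact sets that are both positively invariant for x(k+1) = g(x(k)), and let V be a Lyapunov function for this system with respect to S in D. Then every trajectory starting in D converges to S: for every x(0) ∈ D, |x(k)|_S → 0 as k → ∞, where x(k) = g^k(x(0)). -/
open Set Metric Filter

/-- If a nonnegative sequence decreases at step `k` by at least `w k ≥ 0`, then `w` tends
to zero. -/
lemma tendsto_zero_of_decrease {v w : ℕ → ℝ} (hv : ∀ k, 0 ≤ v k) (hw : ∀ k, 0 ≤ w k)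
    (h : ∀ k, v (k + 1) - v k ≤ -w k) : Tendsto w atTop (nhds 0) := by
  have hsum : ∀ m, ∑ k ∈ Finset.range m, w k ≤ v 0 - v m := by
    intro m
    induction m with
    | zero => simp
    | succ m ih =>
      rw [Finset.sum_range_succ]
      linarith [h m]
  exact (summable_of_sum_range_le hw
    fun m => (hsum m).trans (sub_le_self _ (hv m))).tendsto_atTop_zero

/-- Let `W` be continuous on a compact set `D` and positive on `D \ S`. If `W` tends to zero
along a family of points of `D`, then this family converges to `S`. -/
lemma tendsto_infDist_zero_of_tendsto_zero {X ι : Type*} [PseudoMetricSpace X] {l : Filter ι}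
    {S D : Set X} (hD : IsCompact D) {W : X → ℝ} (hW : ContinuousOn W D)
    (hpos : ∀ x ∈ D \ S, 0 < W x) {u : ι → X} (hu : ∀ i, u i ∈ D)
    (hlim : Tendsto (fun i => W (u i)) l (nhds 0)) :
    Tendsto (fun i => infDist (u i) S) l (nhds 0) := by
  refine tendsto_order.2 ⟨fun a ha => .of_forall fun i => ha.trans_le infDist_nonneg,
    fun ε hε => ?_⟩
  have hK : IsCompact (D ∩ {x | ε ≤ infDist x S}) :=
    hD.inter_right (isClosed_le continuous_const (continuous_infDist_pt S))
  have hKpos : ∀ x ∈ D ∩ {x | ε ≤ infDist x S}, 0 < W x := fun x hx =>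
    hpos x ⟨hx.1, fun hxS => (hε.trans_le hx.2).ne' (infDist_zero_of_mem hxS)⟩
  obtain ⟨c, hc, hcW⟩ := hK.exists_forall_le' (hW.mono inter_subset_left) hKpos
  filter_upwards [hlim.eventually (gt_mem_nhds hc)] with i hi
  by_contra! hle
  exact hi.not_ge (hcW (u i) ⟨hu i, hle⟩)

/-- If `V` is a Lyapunov function for the autonomous system
`x(k+1) = g(x(k))` with respect to the nonempty compact positively invariant set `S`
inside the nonempty compact positively invariant set `D ⊇ S`, then every trajectory
starting in `D` converges to `S`: `|x(k)|_S → 0` as `k → ∞`. -/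
theorem lyapunov_implies_convergence {n : ℕ}
    (g : EuclideanSpace ℝ (Fin n) → EuclideanSpace ℝ (Fin n))
    (S D : Set (EuclideanSpace ℝ (Fin n)))
    (hSne : S.Nonempty) (hDne : D.Nonempty)
    (hScomp : IsCompact S) (hDcomp : IsCompact D)
    (hSD : S ⊆ D)
    (hSinv : ∀ x ∈ S, g x ∈ S) (hDinv : ∀ x ∈ D, g x ∈ D)
    (V ΔV : EuclideanSpace ℝ (Fin n) → ℝ)
    (hVcont : ContinuousOn V D)
    (hVzero : ∀ x ∈ S, V x = 0) (hVpos : ∀ x ∈ D \ S, 0 < V x)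
    (hΔVcont : ContinuousOn ΔV D)
    (hΔVzero : ∀ x ∈ S, ΔV x = 0) (hΔVpos : ∀ x ∈ D \ S, 0 < ΔV x)
    (hdecrease : ∀ x ∈ D, V (g x) - V x ≤ -ΔV x) :
    ∀ x₀ ∈ D, Tendsto (fun k => infDist (g^[k] x₀) S) atTop (nhds 0) := by
  intro x₀ hx₀
  have horbit : ∀ k, g^[k] x₀ ∈ D := fun k => MapsTo.iterate hDinv k hx₀
  have nonneg : ∀ {W : EuclideanSpace ℝ (Fin n) → ℝ}, (∀ x ∈ S, W x = 0) →
      (∀ x ∈ D \ S, 0 < W x) → ∀ k, 0 ≤ W (g^[k] x₀) := fun hzero hpos k =>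
    (em (g^[k] x₀ ∈ S)).elim (fun h => (hzero _ h).ge) fun h => (hpos _ ⟨horbit k, h⟩).le
  refine tendsto_infDist_zero_of_tendsto_zero hDcomp hΔVcont hΔVpos horbit
    (tendsto_zero_of_decrease (nonneg hVzero hVpos) (nonneg hΔVzero hΔVpos) fun k => ?_)
  rw [Function.iterate_succ_apply']
  exact hdecrease _ (horbit k)
end

section
/- Let h : D → ℝ be a discrete-time control barrier function with safe set S = {x ∈ ℝⁿ : h(x) ≤ 0} ⊆ D and decrease function Δh, and let κ : D → U satisfy κ(x) ∈ K_CBF(x) for all x ∈ D, with D positively invariant for the closed-loop map g(x) := f(x, κ(x)). Then V(x) := max(0, h(x)) is a Lyapunov function for the closed-loop system x(k+1) = g(x(k)) with respect to S in D; in particular, with ΔV(x) := max(0, min(Δh(x), V(x))), the inequality V(g(x)) − V(x) ≤ −ΔV(x) holds for all x ∈ D. -/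
open Set Metric Filter

/-- Let `h` be a discrete-time control barrier function on `D` with safe set
`S = {x | h x ≤ 0} ⊆ D` and decrease function `Δh`, and let `κ` satisfy `κ x ∈ K_CBF x`
for all `x ∈ D`, with `D` positively invariant for the closed-loop map `g x = f x (κ x)`.
Then `V x = max 0 (h x)` is a Lyapunov function for the closed loop w.r.t. `S` in `D`;
in particular, with `ΔV x = max 0 (min (Δh x) (V x))`, one has `V (g x) - V x ≤ -ΔV x`
for all `x ∈ D`. -/
theorem cbf_gives_lyapunov_function {n m : ℕ}
    (f : EuclideanSpace ℝ (Fin n) → EuclideanSpace ℝ (Fin m) → EuclideanSpace ℝ (Fin n))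
    (hfcont : Continuous fun p : EuclideanSpace ℝ (Fin n) × EuclideanSpace ℝ (Fin m) => f p.1 p.2)
    (U : Set (EuclideanSpace ℝ (Fin m))) (hUne : U.Nonempty) (hUcomp : IsCompact U)
    (D : Set (EuclideanSpace ℝ (Fin n))) (h : EuclideanSpace ℝ (Fin n) → ℝ)
    (hDne : D.Nonempty) (hDcomp : IsCompact D)
    (hSne : {x : EuclideanSpace ℝ (Fin n) | h x ≤ 0}.Nonempty)
    (hScomp : IsCompact {x : EuclideanSpace ℝ (Fin n) | h x ≤ 0})
    (hSD : {x : EuclideanSpace ℝ (Fin n) | h x ≤ 0} ⊆ D)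
    (hhcont : ContinuousOn h D)
    (Δh : EuclideanSpace ℝ (Fin n) → ℝ) (hΔhcont : ContinuousOn Δh D)
    (hΔhpos : ∀ x ∈ D, ¬ h x ≤ 0 → 0 < Δh x)
    (hcbf1 : ∀ x ∈ D, ¬ h x ≤ 0 → sInf ((fun u => h (f x u)) '' U) - h x ≤ -Δh x)
    (hcbf2 : ∀ x, h x ≤ 0 → sInf ((fun u => h (f x u)) '' U) ≤ 0)
    (κ : EuclideanSpace ℝ (Fin n) → EuclideanSpace ℝ (Fin m))
    (hκU : ∀ x ∈ D, κ x ∈ U)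
    (hκdec : ∀ x ∈ D, ¬ h x ≤ 0 → h (f x (κ x)) - h x ≤ -Δh x)
    (hκsafe : ∀ x ∈ D, h x ≤ 0 → h (f x (κ x)) ≤ 0)
    (hDinv : ∀ x ∈ D, f x (κ x) ∈ D) :
    -- V = max 0 ∘ h is continuous and l.p.d. around S in D
    ContinuousOn (fun x => max 0 (h x)) D ∧
    (∀ x, h x ≤ 0 → max 0 (h x) = 0) ∧
    (∀ x ∈ D, ¬ h x ≤ 0 → 0 < max 0 (h x)) ∧
    -- ΔV = max 0 (min (Δh x) (V x)) is continuous and l.p.d. around S in D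
    ContinuousOn (fun x => max 0 (min (Δh x) (max 0 (h x)))) D ∧
    (∀ x ∈ D, h x ≤ 0 → max 0 (min (Δh x) (max 0 (h x))) = 0) ∧
    (∀ x ∈ D, ¬ h x ≤ 0 → 0 < max 0 (min (Δh x) (max 0 (h x)))) ∧
    -- Lyapunov decrease along the closed loop
    (∀ x ∈ D, max 0 (h (f x (κ x))) - max 0 (h x) ≤ -(max 0 (min (Δh x) (max 0 (h x))))) := by
  have hV : ContinuousOn (fun x => max 0 (h x)) D := ContinuousOn.sup continuousOn_const hhcont
  refine ⟨hV, fun x hx => max_eq_left hx, fun x _ hx => lt_max_of_lt_right (not_le.mp hx),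
    ContinuousOn.sup continuousOn_const (hΔhcont.inf hV), fun x _ hx => ?_, fun x hxD hx => ?_,
    fun x hxD => ?_⟩
  · rw [max_eq_left hx]
    exact max_eq_left (min_le_right _ _)
  · exact lt_max_of_lt_right
      (lt_min (hΔhpos x hxD hx) (lt_max_of_lt_right (not_le.mp hx)))
  · by_cases hx : h x ≤ 0
    · rw [max_eq_left hx, max_eq_left (hκsafe x hxD hx), max_eq_left (min_le_right _ _)]
      simp
    · have hpos := not_le.mp hx
      have hdec := hκdec x hxD hx
      rw [max_eq_right hpos.le, max_eq_right (le_min (hΔhpos x hxD hx).le hpos.le)]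
      have hmin_left := min_le_left (Δh x) (h x)
      have hmin_right := min_le_right (Δh x) (h x)
      rcases max_cases 0 (h (f x (κ x))) with ⟨hmax, _⟩ | ⟨hmax, _⟩ <;> linarith
end
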